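/- Suppose 0 < α < minᵢ λᵢ. Then for all δ₁, δ₂ with 0 ≤ δ₁ ≤ δ₂ ≤ α/2, one has f_α(δ₂) ≤ f_α(δ₁) (f_α is nonincreasing on [0, α/2]), and for all δ₁, δ₂ with α/2 ≤ δ₁ ≤ δ₂ < minᵢ λᵢ, one has f_α(δ₁) ≤ f_α(δ₂) (f_α is nondecreasing on [α/2, minᵢ λᵢ)). -/

import Mathlib

open Matrix

/-- `W(δ) = U · diag(√(λᵢ − δ))`. -/
noncomputable def Wmat {M P : ℕ} (U : Matrix (Fin M) (Fin P) ℝ) (lam : Fin P → ℝ)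
    (δ : ℝ) : Matrix (Fin M) (Fin P) ℝ :=
  U * Matrix.diagonal (fun i => Real.sqrt (lam i - δ))

/-- `ẑ(δ) = L⁻¹ · diag(√(λᵢ − δ)) · Uᵀ x`. -/
noncomputable def zhat {M P : ℕ} (U : Matrix (Fin M) (Fin P) ℝ) (lam : Fin P → ℝ)
    (δ : ℝ) (x : Fin M → ℝ) : Fin P → ℝ :=
  ((Matrix.diagonal lam)⁻¹ * Matrix.diagonal (fun i => Real.sqrt (lam i - δ)) * Uᵀ).mulVec x

/-- Squared Euclidean norm on `ℝ^M`. -/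
noncomputable def enormSq {M : ℕ} (v : Fin M → ℝ) : ℝ :=
  ‖(EuclideanSpace.equiv (Fin M) ℝ).symm v‖ ^ 2

/-- `f_α(δ) = (1/2)·(ẑ(δ)ᵀẑ(δ) + (1/α)·‖x − W(δ)ẑ(δ)‖²)`. -/
noncomputable def fA {M P : ℕ} (U : Matrix (Fin M) (Fin P) ℝ) (lam : Fin P → ℝ)
    (x : Fin M → ℝ) (α δ : ℝ) : ℝ :=
  (1 / 2) * (zhat U lam δ x ⬝ᵥ zhat U lam δ x +
    (1 / α) * enormSq (x - (Wmat U lam δ).mulVec (zhat U lam δ x)))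

lemma enormSq_eq_dotProduct {M : ℕ} (v : Fin M → ℝ) : enormSq v = v ⬝ᵥ v := by
  rw [enormSq, EuclideanSpace.norm_sq_eq]
  simp [dotProduct, sq]

/-- Pythagoras for the residual of `x` against the range of a matrix with orthonormal columns. -/
lemma dotProduct_self_sub_mulVec {m p : Type*} [Fintype m] [Fintype p] [DecidableEq p]
    {U : Matrix m p ℝ} (hU : Uᵀ * U = 1) (x : m → ℝ) (w : p → ℝ) :
    (x - U *ᵥ w) ⬝ᵥ (x - U *ᵥ w) =
      x ⬝ᵥ x - (Uᵀ *ᵥ x) ⬝ᵥ (Uᵀ *ᵥ x) + (Uᵀ *ᵥ x - w) ⬝ᵥ (Uᵀ *ᵥ x - w) := by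
  have hcross : x ⬝ᵥ U *ᵥ w = (Uᵀ *ᵥ x) ⬝ᵥ w := by
    rw [dotProduct_mulVec, mulVec_transpose]
  have hself : (U *ᵥ w) ⬝ᵥ (U *ᵥ w) = w ⬝ᵥ w := by
    rw [dotProduct_mulVec, ← mulVec_transpose, mulVec_mulVec, hU, one_mulVec]
  simp only [sub_dotProduct, dotProduct_sub, hself, dotProduct_comm (U *ᵥ w) x, hcross,
    dotProduct_comm w (Uᵀ *ᵥ x)]
  ring

lemma zhat_apply {M P : ℕ} (U : Matrix (Fin M) (Fin P) ℝ) {lam : Fin P → ℝ}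
    (hlam : ∀ i, lam i ≠ 0) (δ : ℝ) (x : Fin M → ℝ) (i : Fin P) :
    zhat U lam δ x i = (lam i)⁻¹ * Real.sqrt (lam i - δ) * (Uᵀ *ᵥ x) i := by
  have hinv : (diagonal lam)⁻¹ = diagonal fun i => (lam i)⁻¹ := by
    refine inv_eq_left_inv ?_
    rw [diagonal_mul_diagonal, ← diagonal_one]
    congr 1
    ext i
    exact inv_mul_cancel₀ (hlam i)
  rw [zhat, hinv, diagonal_mul_diagonal, ← mulVec_mulVec, mulVec_diagonal]

/-- In the coordinates `Uᵀ x`, `f_α` is a sum of quadratics in `δ` with vertex at `α / 2`. -/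
lemma fA_eq_sum {M P : ℕ} {U : Matrix (Fin M) (Fin P) ℝ} (hU : Uᵀ * U = 1)
    {lam : Fin P → ℝ} (hlam : ∀ i, lam i ≠ 0) (x : Fin M → ℝ) (α : ℝ) {δ : ℝ}
    (hδ : ∀ i, δ ≤ lam i) :
    fA U lam x α δ = (1 / 2) * ((1 / α) * (x ⬝ᵥ x - (Uᵀ *ᵥ x) ⬝ᵥ (Uᵀ *ᵥ x)) +
      ∑ i, ((Uᵀ *ᵥ x) i / lam i) ^ 2 * (lam i - δ + δ ^ 2 / α)) := by
  rw [fA, enormSq_eq_dotProduct, Wmat, ← mulVec_mulVec, dotProduct_self_sub_mulVec hU,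
    mul_add (1 / α), add_left_comm]
  congr 2
  simp only [dotProduct, Finset.mul_sum, ← Finset.sum_add_distrib]
  refine Finset.sum_congr rfl fun i _ => ?_
  have hs := Real.sq_sqrt (sub_nonneg.2 (hδ i))
  have hi := hlam i
  have hres : (Uᵀ *ᵥ x - diagonal (fun i => Real.sqrt (lam i - δ)) *ᵥ zhat U lam δ x) i =
      δ * ((Uᵀ *ᵥ x) i / lam i) := by
    rw [Pi.sub_apply, mulVec_diagonal, zhat_apply U hlam]
    field_simp
    rw [hs]
    ring
  rw [hres, zhat_apply U hlam]
  linear_combination ((Uᵀ *ᵥ x) i / lam i) ^ 2 * hs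

lemma fA_le_fA {M P : ℕ} {U : Matrix (Fin M) (Fin P) ℝ} (hU : Uᵀ * U = 1)
    {lam : Fin P → ℝ} (hlam : ∀ i, lam i ≠ 0) (x : Fin M → ℝ) {α : ℝ} (hα : 0 < α) {δ δ' : ℝ}
    (hδ : ∀ i, δ ≤ lam i) (hδ' : ∀ i, δ' ≤ lam i) (h : 0 ≤ (δ' - δ) * (δ + δ' - α)) :
    fA U lam x α δ ≤ fA U lam x α δ' := by
  have hq : δ ^ 2 / α - δ ≤ δ' ^ 2 / α - δ' := by
    have hdiff : δ' ^ 2 / α - δ' - (δ ^ 2 / α - δ) = (δ' - δ) * (δ + δ' - α) / α := by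
      field_simp
      ring
    have := div_nonneg h hα.le
    linarith
  rw [fA_eq_sum hU hlam x α hδ, fA_eq_sum hU hlam x α hδ']
  gcongr (1 / 2) * (_ + ∑ i, _ * ?_) with i
  linarith

/-- `f_α` is nonincreasing on `[0, α/2]` and nondecreasing on
`[α/2, minᵢ λᵢ)`. -/
theorem fA_monotonicity (M P : ℕ) (hM : 0 < M) (hP : 0 < P)
    (x : Fin M → ℝ)
    (U : Matrix (Fin M) (Fin P) ℝ)
    (hU : Uᵀ * U = (1 : Matrix (Fin P) (Fin P) ℝ))
    (lam : Fin P → ℝ) (hlam : ∀ i, 0 < lam i)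
    (α : ℝ) (hα : 0 < α) (hαlam : ∀ i, α < lam i) :
    (∀ δ₁ δ₂ : ℝ, 0 ≤ δ₁ → δ₁ ≤ δ₂ → δ₂ ≤ α / 2 →
      fA U lam x α δ₂ ≤ fA U lam x α δ₁) ∧
    (∀ δ₁ δ₂ : ℝ, α / 2 ≤ δ₁ → δ₁ ≤ δ₂ → (∀ i, δ₂ < lam i) →
      fA U lam x α δ₁ ≤ fA U lam x α δ₂) := by
  have hne : ∀ i, lam i ≠ 0 := fun i => (hlam i).ne'
  refine ⟨fun δ₁ δ₂ _ h₁₂ h₂ => ?_, fun δ₁ δ₂ h₁ h₁₂ h₂ => ?_⟩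
  · refine fA_le_fA hU hne x hα (fun i => ?_) (fun i => ?_)
      (mul_nonneg_of_nonpos_of_nonpos (by linarith) (by linarith)) <;> linarith [hαlam i]
  · exact fA_le_fA hU hne x hα (fun i => h₁₂.trans (h₂ i).le) (fun i => (h₂ i).le)
      (mul_nonneg (by linarith) (by linarith))
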